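/- Let ω₁, ω₂, ω₃, ω₄ be ℝ-linearly independent quaternions with lattice Λ = {w_k : k ∈ ℤ⁴}, w_k = 2(k₁ω₁ + ⋯ + k₄ω₄), and let ζ₄ be the associated Weierstrass zeta function on ℍ \ Λ. Then ζ₄ is smooth on ℍ \ Λ, and writing ζ₄ = g₀ + g₁i + g₂j + g₃k with real component functions g₀,g₁,g₂,g₃ of (x₀,x₁,x₂,x₃) ∈ ℝ⁴ \ Λ, each component g_a is biharmonic (Δ(Δg_a) = 0), and the functions G_a = Δg_a satisfy the system ∂₀G₀ = ∂₁G₁ + ∂₂G₂ + ∂₃G₃; ∂₀G_l = −∂_l G₀ for l = 1,2,3; and ∂_i G_j = ∂_j G_i for 1 ≤ i < j ≤ 3, on ℝ⁴ \ Λ. -/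

import Mathlib

noncomputable section

/-- The standard basis `1, i, j, k` of the quaternions, viewed as ℝ⁴. -/
def qbasis : Fin 4 → Quaternion ℝ :=
  ![1, ⟨0, 1, 0, 0⟩, ⟨0, 0, 1, 0⟩, ⟨0, 0, 0, 1⟩]

/-- The real components of a quaternion `x = x₀ + x₁i + x₂j + x₃k`. -/
def qcomp : Fin 4 → Quaternion ℝ → ℝ :=
  ![fun q => q.re, fun q => q.imI, fun q => q.imJ, fun q => q.imK]

/-- The partial derivative `∂_i f` of `f : ℍ → ℝ` with respect to the identification
`ℍ ≅ ℝ⁴`. -/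
def pd (i : Fin 4) (f : Quaternion ℝ → ℝ) : Quaternion ℝ → ℝ :=
  fun x => fderiv ℝ f x (qbasis i)

/-- The Laplacian `Δ = Σ_{i=0}^{3} ∂_i²` of `f : ℍ → ℝ`. -/
def laplacian (f : Quaternion ℝ → ℝ) : Quaternion ℝ → ℝ :=
  fun x => ∑ i : Fin 4, pd i (pd i f) x

/-- The lattice vector `w_k = 2(k₁ω₁ + ⋯ + k₄ω₄)` in the quaternions. -/
def wk (ω : Fin 4 → Quaternion ℝ) (k : Fin 4 → ℤ) : Quaternion ℝ :=
  2 * ∑ i : Fin 4, (k i : ℝ) • ω i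

/-- The Weierstrass zeta function `ζ₄`. -/
def zeta4 (ω : Fin 4 → Quaternion ℝ) (x : Quaternion ℝ) : Quaternion ℝ :=
  x⁻¹ + ∑' k : {k : Fin 4 → ℤ // k ≠ 0},
    ((x - wk ω k.1)⁻¹ +
      ∑ μ ∈ Finset.range 4, ((wk ω k.1)⁻¹ * x) ^ μ * (wk ω k.1)⁻¹)

open Filter Topology

section DirectionalDerivatives

variable {V W : Type*} [NormedAddCommGroup V] [NormedSpace ℝ V]
  [NormedAddCommGroup W] [NormedSpace ℝ W]

/-- The partial derivative `∂_i F` of a vector-valued function on the quaternions. -/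
def vpd (i : Fin 4) (F : Quaternion ℝ → V) : Quaternion ℝ → V :=
  fun x => fderiv ℝ F x (qbasis i)

/-- The Laplacian of a vector-valued function on the quaternions. -/
def vlaplacian (F : Quaternion ℝ → V) : Quaternion ℝ → V :=
  fun x => ∑ i : Fin 4, vpd i (vpd i F) x

theorem AnalyticAt.vpd [CompleteSpace V] {F : Quaternion ℝ → V} {x : Quaternion ℝ}
    (hF : AnalyticAt ℝ F x) (i : Fin 4) : AnalyticAt ℝ (vpd i F) x :=
  ((ContinuousLinearMap.apply ℝ V (qbasis i)).analyticAt _).comp hF.fderiv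

theorem AnalyticAt.vlaplacian [CompleteSpace V] {F : Quaternion ℝ → V} {x : Quaternion ℝ}
    (hF : AnalyticAt ℝ F x) : AnalyticAt ℝ (vlaplacian F) x :=
  Finset.univ.analyticAt_fun_sum fun i _ => (hF.vpd i).vpd i

theorem Filter.EventuallyEq.vpd {F G : Quaternion ℝ → V} {x : Quaternion ℝ}
    (h : F =ᶠ[𝓝 x] G) (i : Fin 4) : vpd i F =ᶠ[𝓝 x] vpd i G :=
  h.fderiv.fun_comp (· (qbasis i))

theorem Filter.EventuallyEq.vlaplacian {F G : Quaternion ℝ → V} {x : Quaternion ℝ}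
    (h : F =ᶠ[𝓝 x] G) : vlaplacian F =ᶠ[𝓝 x] vlaplacian G := by
  have h2 : ∀ᶠ y in 𝓝 x, ∀ i, _root_.vpd i (_root_.vpd i F) y = _root_.vpd i (_root_.vpd i G) y :=
    eventually_all.2 fun i => (h.vpd i).vpd i
  filter_upwards [h2] with y hy
  simp [_root_.vlaplacian, hy]

theorem vpd_clm_comp [CompleteSpace V] (L : V →L[ℝ] W) {F : Quaternion ℝ → V}
    {x : Quaternion ℝ} (hF : AnalyticAt ℝ F x) (i : Fin 4) :
    vpd i (fun y => L (F y)) =ᶠ[𝓝 x] fun y => L (vpd i F y) := by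
  filter_upwards [hF.eventually_analyticAt] with y hy
  have h := (L.hasFDerivAt.comp y hy.differentiableAt.hasFDerivAt).fderiv
  simp only [vpd]
  erw [h]
  rfl

theorem vlaplacian_clm_comp [CompleteSpace V] (L : V →L[ℝ] W) {F : Quaternion ℝ → V}
    {x : Quaternion ℝ} (hF : AnalyticAt ℝ F x) :
    vlaplacian (fun y => L (F y)) =ᶠ[𝓝 x] fun y => L (vlaplacian F y) := by
  have h : ∀ᶠ y in 𝓝 x, ∀ i, vpd i (vpd i fun y => L (F y)) y = L (vpd i (vpd i F) y) :=
    eventually_all.2 fun i =>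
      ((vpd_clm_comp L hF i).vpd i).trans (vpd_clm_comp L (hF.vpd i) i)
  filter_upwards [h] with y hy
  simp [vlaplacian, hy]

theorem vpd_vlaplacian_clm_comp [CompleteSpace V] (L : V →L[ℝ] W) {F : Quaternion ℝ → V}
    {x : Quaternion ℝ} (hF : AnalyticAt ℝ F x) (i : Fin 4) :
    vpd i (vlaplacian fun y => L (F y)) x = L (vpd i (vlaplacian F) x) :=
  (((vlaplacian_clm_comp L hF).vpd i).trans (vpd_clm_comp L hF.vlaplacian i)).eq_of_nhds

theorem vpd_add {F G : Quaternion ℝ → V} {x : Quaternion ℝ} (hF : DifferentiableAt ℝ F x)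
    (hG : DifferentiableAt ℝ G x) (i : Fin 4) :
    vpd i (fun y => F y + G y) x = vpd i F x + vpd i G x := by
  simp [vpd, fderiv_fun_add hF hG]

theorem vpd_vlaplacian_add [CompleteSpace V] {F G : Quaternion ℝ → V} {x : Quaternion ℝ}
    (hF : AnalyticAt ℝ F x) (hG : AnalyticAt ℝ G x) (i : Fin 4) :
    vpd i (vlaplacian fun y => F y + G y) x =
      vpd i (vlaplacian F) x + vpd i (vlaplacian G) x := by
  have h := vpd_vlaplacian_clm_comp (ContinuousLinearMap.fst ℝ V V + ContinuousLinearMap.snd ℝ V V)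
    (hF.prod hG) i
  have h1 := vpd_vlaplacian_clm_comp (ContinuousLinearMap.fst ℝ V V) (hF.prod hG) i
  have h2 := vpd_vlaplacian_clm_comp (ContinuousLinearMap.snd ℝ V V) (hF.prod hG) i
  simp only [add_apply, ContinuousLinearMap.coe_fst',
    ContinuousLinearMap.coe_snd'] at h h1 h2
  rw [h, h1, h2]

theorem vpd_comm [CompleteSpace V] {F : Quaternion ℝ → V} {x : Quaternion ℝ}
    (hF : AnalyticAt ℝ F x) (i j : Fin 4) : vpd i (vpd j F) x = vpd j (vpd i F) x := by
  have key : ∀ i j : Fin 4,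
      vpd i (vpd j F) x = fderiv ℝ (fderiv ℝ F) x (qbasis i) (qbasis j) := fun i j => by
    have h := ((ContinuousLinearMap.apply ℝ V (qbasis j)).hasFDerivAt.comp x
      hF.fderiv.differentiableAt.hasFDerivAt).fderiv
    exact congrArg (· (qbasis i)) h
  rw [key, key]
  exact (hF.contDiffAt (n := 2)).isSymmSndFDerivAt (by simp) _ _

end DirectionalDerivatives

section AlgebraicTerms

theorem vpd_mul {F G : Quaternion ℝ → Quaternion ℝ} {x : Quaternion ℝ}
    (hF : DifferentiableAt ℝ F x) (hG : DifferentiableAt ℝ G x) (i : Fin 4) :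
    vpd i (fun y => F y * G y) x = F x * vpd i G x + vpd i F x * G x := by
  have h := (hF.hasFDerivAt.mul' hG.hasFDerivAt).fderiv
  exact congrArg (· (qbasis i)) h

theorem vpd_const (c : Quaternion ℝ) (i : Fin 4) (x : Quaternion ℝ) :
    vpd i (fun _ => c) x = 0 := by
  simp [vpd]

theorem vpd_const_mul_id (a : Quaternion ℝ) (i : Fin 4) (x : Quaternion ℝ) :
    vpd i (fun y => a * y) x = a * qbasis i :=
  congrArg (· (qbasis i)) ((ContinuousLinearMap.mul ℝ (Quaternion ℝ) a).fderiv (x := x))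

theorem vpd_fun_sum {F : Fin 4 → Quaternion ℝ → Quaternion ℝ} {x : Quaternion ℝ}
    (hF : ∀ j, DifferentiableAt ℝ (F j) x) (i : Fin 4) :
    vpd i (fun y => ∑ j, F j y) x = ∑ j, vpd i (F j) x := by
  simp [vpd, fderiv_fun_sum fun j _ => hF j]

theorem vpd_sub_inv {w y : Quaternion ℝ} (hy : y ≠ w) (i : Fin 4) :
    vpd i (fun z => (z - w)⁻¹) y = -((y - w)⁻¹ * qbasis i * (y - w)⁻¹) := by
  have h := ((hasFDerivAt_inv' (𝕜 := ℝ) (sub_ne_zero.2 hy)).comp y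
    ((hasFDerivAt_id y).sub_const w)).fderiv
  exact congrArg (· (qbasis i)) h

theorem analyticAt_sub_inv {w x : Quaternion ℝ} (hx : x ≠ w) :
    AnalyticAt ℝ (fun y => (y - w)⁻¹) x :=
  (analyticAt_id.sub analyticAt_const).inv (sub_ne_zero.2 hx)

/-- The third-order expression in `a` that arises both from `∂_i Δ` of `(x - w)⁻¹`
(with `a = (x - w)⁻¹`) and from `∂_i Δ` of the cubic `(a x)³ a`. -/
def cubicTerm (a : Quaternion ℝ) (i : Fin 4) : Quaternion ℝ :=
  ∑ j : Fin 4, (a * qbasis i * a * qbasis j * a * qbasis j * a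
    + a * qbasis j * a * qbasis i * a * qbasis j * a
    + a * qbasis j * a * qbasis j * a * qbasis i * a)

theorem vlaplacian_sub_inv {w y : Quaternion ℝ} (hy : y ≠ w) :
    vlaplacian (fun z => (z - w)⁻¹) y =
      ∑ j : Fin 4, (2 * ((y - w)⁻¹ * qbasis j * (y - w)⁻¹ * qbasis j * (y - w)⁻¹)) := by
  have hd := (analyticAt_sub_inv hy).differentiableAt
  refine Finset.sum_congr rfl fun j _ => ?_
  have h : vpd j (fun z => (z - w)⁻¹) =ᶠ[𝓝 y]
      fun z => (-1) * ((z - w)⁻¹ * qbasis j * (z - w)⁻¹) := by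
    filter_upwards [isOpen_ne.mem_nhds hy] with z hz
    rw [vpd_sub_inv hz, neg_one_mul]
  rw [(h.vpd j).eq_of_nhds]
  simp (disch := fun_prop (disch := assumption)) only [vpd_mul, vpd_const, vpd_sub_inv hy]
  noncomm_ring

theorem vpd_vlaplacian_sub_inv {w x : Quaternion ℝ} (hx : x ≠ w) (i : Fin 4) :
    vpd i (vlaplacian fun z => (z - w)⁻¹) x = (-2 : ℝ) • cubicTerm (x - w)⁻¹ i := by
  have hd := (analyticAt_sub_inv hx).differentiableAt
  have h : vlaplacian (fun z => (z - w)⁻¹) =ᶠ[𝓝 x] fun y =>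
      ∑ j : Fin 4, (2 * ((y - w)⁻¹ * qbasis j * (y - w)⁻¹ * qbasis j * (y - w)⁻¹)) := by
    filter_upwards [isOpen_ne.mem_nhds hx] with y hy using vlaplacian_sub_inv hy
  rw [(h.vpd i).eq_of_nhds, vpd_fun_sum fun j => by fun_prop, cubicTerm, Finset.smul_sum]
  refine Finset.sum_congr rfl fun j _ => ?_
  simp (disch := fun_prop (disch := assumption)) only [vpd_mul, vpd_const, vpd_sub_inv hx]
  have h2 : ∀ q : Quaternion ℝ, (-2 : ℝ) • q = (-2) * q := fun q => by
    rw [neg_smul, two_smul, neg_mul, two_mul]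
  rw [h2]
  noncomm_ring

theorem vpd_vlaplacian_cubic (a x : Quaternion ℝ) (i : Fin 4) :
    vpd i (vlaplacian fun y => (a * y) ^ 3 * a) x = (2 : ℝ) • cubicTerm a i := by
  have h0 : (fun y => (a * y) ^ 3 * a) = fun y => a * y * (a * y) * (a * y) * a := by
    funext y; noncomm_ring
  have h1 : ∀ j, vpd j (fun y => (a * y) ^ 3 * a) = fun y =>
      a * y * (a * y) * (a * qbasis j) * a + a * y * (a * qbasis j) * (a * y) * a
        + a * qbasis j * (a * y) * (a * y) * a := fun j => by
    funext y
    rw [h0]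
    simp (disch := fun_prop) only [vpd_mul, vpd_const, vpd_const_mul_id]
    noncomm_ring
  have h2 : vlaplacian (fun y => (a * y) ^ 3 * a) = fun y => ∑ j : Fin 4,
      2 * (a * y * (a * qbasis j) * (a * qbasis j) * a
        + a * qbasis j * (a * y) * (a * qbasis j) * a
        + a * qbasis j * (a * qbasis j) * (a * y) * a) := by
    funext y
    refine Finset.sum_congr rfl fun j _ => ?_
    rw [h1]
    simp (disch := fun_prop) only [vpd_mul, vpd_add, vpd_const, vpd_const_mul_id]
    noncomm_ring
  rw [h2, vpd_fun_sum fun j => by fun_prop, cubicTerm, Finset.smul_sum]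
  refine Finset.sum_congr rfl fun j _ => ?_
  simp (disch := fun_prop) only [vpd_mul, vpd_add, vpd_const, vpd_const_mul_id]
  rw [two_smul ℝ]
  noncomm_ring

theorem vpd_vlaplacian_quadratic (a x : Quaternion ℝ) (i : Fin 4) :
    vpd i (vlaplacian fun y => (a * y) ^ 2 * a) x = 0 := by
  have h0 : (fun y => (a * y) ^ 2 * a) = fun y => a * y * (a * y) * a := by
    funext y; noncomm_ring
  have h1 : ∀ j, vpd j (fun y => (a * y) ^ 2 * a) = fun y =>
      a * y * (a * qbasis j) * a + a * qbasis j * (a * y) * a := fun j => by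
    funext y
    rw [h0]
    simp (disch := fun_prop) only [vpd_mul, vpd_const, vpd_const_mul_id]
    noncomm_ring
  have h2 : vlaplacian (fun y => (a * y) ^ 2 * a) = fun _ => ∑ j : Fin 4,
      2 * (a * qbasis j * (a * qbasis j) * a) := by
    funext y
    refine Finset.sum_congr rfl fun j _ => ?_
    rw [h1]
    simp (disch := fun_prop) only [vpd_mul, vpd_add, vpd_const, vpd_const_mul_id]
    noncomm_ring
  rw [h2, vpd_const]

theorem vpd_vlaplacian_affine (a b x : Quaternion ℝ) (i : Fin 4) :
    vpd i (vlaplacian fun y => b + a * y * a) x = 0 := by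
  have h1 : ∀ j, vpd j (fun y => b + a * y * a) = fun _ => a * qbasis j * a := fun j => by
    funext y
    simp (disch := fun_prop) [vpd_mul, vpd_add, vpd_const, vpd_const_mul_id]
  have h2 : vlaplacian (fun y => b + a * y * a) = fun _ => 0 := by
    funext y
    simp [vlaplacian, h1, vpd_const]
  rw [h2, vpd_const]

end AlgebraicTerms

section CauchyRiemannSystem

/-- The `a`-th real component as a continuous linear functional. -/
def qcompL (a : Fin 4) : Quaternion ℝ →L[ℝ] ℝ :=
  LinearMap.toContinuousLinearMap
    { toFun := qcomp a
      map_add' := fun p q => by fin_cases a <;> simp [qcomp]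
      map_smul' := fun c q => by fin_cases a <;> simp [qcomp] }

theorem qcomp_add (a : Fin 4) (p q : Quaternion ℝ) :
    qcomp a (p + q) = qcomp a p + qcomp a q :=
  map_add (qcompL a) p q

theorem qcomp_smul (a : Fin 4) (c : ℝ) (q : Quaternion ℝ) :
    qcomp a (c • q) = c * qcomp a q :=
  map_smul (qcompL a) c q

theorem qcomp_zero (a : Fin 4) : qcomp a 0 = 0 :=
  map_zero (qcompL a)

/-- The tuples `(∂₀G, ∂₁G, ∂₂G, ∂₃G)` allowed by the Cauchy–Riemann–Fueter system. -/
def fueterSystem : Submodule ℝ (Fin 4 → Quaternion ℝ) where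
  carrier := {M | qcomp 0 (M 0) = qcomp 1 (M 1) + qcomp 2 (M 2) + qcomp 3 (M 3) ∧
    (∀ l, l ≠ 0 → qcomp l (M 0) = -qcomp 0 (M l)) ∧
    ∀ i j, i ≠ 0 → j ≠ 0 → qcomp j (M i) = qcomp i (M j)}
  add_mem' := by
    rintro M N ⟨hM1, hM2, hM3⟩ ⟨hN1, hN2, hN3⟩
    refine ⟨?_, fun l hl => ?_, fun i j hi hj => ?_⟩
    · simp only [Pi.add_apply, qcomp_add]
      linarith
    · simp only [Pi.add_apply, qcomp_add, hM2 l hl, hN2 l hl]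
      ring
    · simp only [Pi.add_apply, qcomp_add, hM3 i j hi hj, hN3 i j hi hj]
  zero_mem' := by simp [qcomp_zero]
  smul_mem' := by
    rintro c M ⟨hM1, hM2, hM3⟩
    refine ⟨?_, fun l hl => ?_, fun i j hi hj => ?_⟩
    · simp only [Pi.smul_apply, qcomp_smul, hM1]
      ring
    · simp only [Pi.smul_apply, qcomp_smul, hM2 l hl]
      ring
    · simp only [Pi.smul_apply, qcomp_smul, hM3 i j hi hj]

theorem qbasis_re (i : Fin 4) : (qbasis i).re = if i = 0 then 1 else 0 := by
  fin_cases i <;> rfl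

theorem qbasis_imI (i : Fin 4) : (qbasis i).imI = if i = 1 then 1 else 0 := by
  fin_cases i <;> rfl

theorem qbasis_imJ (i : Fin 4) : (qbasis i).imJ = if i = 2 then 1 else 0 := by
  fin_cases i <;> rfl

theorem qbasis_imK (i : Fin 4) : (qbasis i).imK = if i = 3 then 1 else 0 := by
  fin_cases i <;> rfl

theorem sum_qbasis_mul_mul_qbasis (q : Quaternion ℝ) :
    ∑ j : Fin 4, qbasis j * q * qbasis j = (-2 : ℝ) • star q := by
  ext <;> simp [Fin.sum_univ_four, qbasis_re, qbasis_imI, qbasis_imJ, qbasis_imK] <;> ring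

theorem cubicTerm_eq (a : Quaternion ℝ) (i : Fin 4) :
    cubicTerm a i = (-4 * Quaternion.normSq a) • (a * qbasis i * a) +
      (-2 * Quaternion.normSq a ^ 2) • star (qbasis i) := by
  have h : cubicTerm a i = a * qbasis i * a * (∑ j : Fin 4, qbasis j * a * qbasis j) * a
      + a * (∑ j : Fin 4, qbasis j * (a * qbasis i * a) * qbasis j) * a
      + a * (∑ j : Fin 4, qbasis j * a * qbasis j) * a * qbasis i * a := by
    simp only [cubicTerm, Finset.sum_add_distrib, Finset.mul_sum, Finset.sum_mul, mul_assoc]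
  have h1 : a * star a = ((Quaternion.normSq a : ℝ) : Quaternion ℝ) := Quaternion.self_mul_star a
  have h2 : star a * a = ((Quaternion.normSq a : ℝ) : Quaternion ℝ) := Quaternion.star_mul_self a
  have e1 : a * qbasis i * a * star a * a = Quaternion.normSq a • (a * qbasis i * a) := by
    rw [mul_assoc (a * qbasis i * a), h2, Quaternion.mul_coe_eq_smul]
  have e2 : a * star (a * qbasis i * a) * a = Quaternion.normSq a ^ 2 • star (qbasis i) := by
    calc a * star (a * qbasis i * a) * a
        = (a * star a) * star (qbasis i) * (star a * a) := by
          simp only [star_mul, mul_assoc]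
      _ = _ := by
        rw [h1, h2, Quaternion.coe_mul_eq_smul, Quaternion.mul_coe_eq_smul, smul_smul, sq]
  have e3 : a * star a * a * qbasis i * a = Quaternion.normSq a • (a * qbasis i * a) := by
    rw [h1, Quaternion.coe_mul_eq_smul, smul_mul_assoc, smul_mul_assoc]
  rw [h, sum_qbasis_mul_mul_qbasis, sum_qbasis_mul_mul_qbasis]
  simp only [mul_smul_comm, smul_mul_assoc, e1, e2, e3]
  module

theorem cubicTerm_mem_fueterSystem (a : Quaternion ℝ) : cubicTerm a ∈ fueterSystem := by
  refine ⟨?_, fun l hl => ?_, fun i j hi hj => ?_⟩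
  · simp [cubicTerm_eq, Quaternion.normSq_def', qcomp, qbasis_re, qbasis_imI, qbasis_imJ,
      qbasis_imK]
    ring
  · simp only [cubicTerm_eq, qcomp_add, qcomp_smul]
    fin_cases l <;> simp [qcomp, qbasis_re, qbasis_imI, qbasis_imJ, qbasis_imK] at hl ⊢ <;> ring
  · simp only [cubicTerm_eq, qcomp_add, qcomp_smul]
    fin_cases i <;> fin_cases j <;>
      simp [qcomp, qbasis_re, qbasis_imI, qbasis_imJ, qbasis_imK,
        -mul_eq_mul_left_iff] at hi hj ⊢ <;> ring

/-- `F` is analytic at `x` and `DΔF` vanishes there, in componentwise form. -/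
def HolCliffordianAt (F : Quaternion ℝ → Quaternion ℝ) (x : Quaternion ℝ) : Prop :=
  AnalyticAt ℝ F x ∧ (fun i => vpd i (vlaplacian F) x) ∈ fueterSystem

namespace HolCliffordianAt

variable {F G : Quaternion ℝ → Quaternion ℝ} {x : Quaternion ℝ}

theorem congr (hF : HolCliffordianAt F x) (h : F =ᶠ[𝓝 x] G) : HolCliffordianAt G x := by
  refine ⟨hF.1.congr h, ?_⟩
  have e : (fun i => vpd i (vlaplacian G) x) = fun i => vpd i (vlaplacian F) x :=
    funext fun i => (h.vlaplacian.vpd i).eq_of_nhds.symm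
  rw [e]
  exact hF.2

theorem add (hF : HolCliffordianAt F x) (hG : HolCliffordianAt G x) :
    HolCliffordianAt (fun y => F y + G y) x := by
  refine ⟨hF.1.fun_add hG.1, ?_⟩
  simp only [vpd_vlaplacian_add hF.1 hG.1]
  exact fueterSystem.add_mem hF.2 hG.2

theorem zero : HolCliffordianAt (fun _ => 0) x := by
  refine ⟨analyticAt_const, ?_⟩
  have h := vpd_vlaplacian_affine 0 0 x
  simp only [zero_mul, add_zero] at h
  simp only [h]
  exact fueterSystem.zero_mem

theorem sum {κ : Type*} (s : Finset κ) {F : κ → Quaternion ℝ → Quaternion ℝ}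
    (hF : ∀ k ∈ s, HolCliffordianAt (F k) x) :
    HolCliffordianAt (fun y => ∑ k ∈ s, F k y) x := by
  classical
  induction s using Finset.induction_on with
  | empty => simpa using zero
  | insert k s hk ih =>
    simp only [Finset.sum_insert hk]
    exact (hF k (Finset.mem_insert_self k s)).add
      (ih fun l hl => hF l (Finset.mem_insert_of_mem hl))

theorem sub_inv {w : Quaternion ℝ} (hx : x ≠ w) :
    HolCliffordianAt (fun y => (y - w)⁻¹) x := by
  refine ⟨analyticAt_sub_inv hx, ?_⟩
  simp only [vpd_vlaplacian_sub_inv hx]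
  exact fueterSystem.smul_mem _ (cubicTerm_mem_fueterSystem _)

theorem sum_pow_mul (a : Quaternion ℝ) :
    HolCliffordianAt (fun y => ∑ μ ∈ Finset.range 4, (a * y) ^ μ * a) x := by
  have hy : AnalyticAt ℝ (fun y : Quaternion ℝ => y) x := analyticAt_id
  have hp : ∀ n : ℕ, AnalyticAt ℝ (fun y => (a * y) ^ n * a) x := fun n =>
    ((analyticAt_const.fun_mul hy).fun_pow n).fun_mul analyticAt_const
  have h1 : HolCliffordianAt (fun y => a + a * y * a) x := by
    refine ⟨analyticAt_const.fun_add ((analyticAt_const.fun_mul hy).fun_mul analyticAt_const), ?_⟩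
    simp only [vpd_vlaplacian_affine]
    exact fueterSystem.zero_mem
  have h2 : HolCliffordianAt (fun y => (a * y) ^ 2 * a) x := by
    refine ⟨hp 2, ?_⟩
    simp only [vpd_vlaplacian_quadratic]
    exact fueterSystem.zero_mem
  have h3 : HolCliffordianAt (fun y => (a * y) ^ 3 * a) x := by
    refine ⟨hp 3, ?_⟩
    simp only [vpd_vlaplacian_cubic]
    exact fueterSystem.smul_mem _ (cubicTerm_mem_fueterSystem _)
  simpa [Finset.sum_range_succ] using (h1.add h2).add h3

end HolCliffordianAt

end CauchyRiemannSystem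

section LatticeSeries

open BoundedContinuousFunction

variable {ι : Type*} [TopologicalSpace ι]

theorem summable_smul_boundedContinuousFunction {c : ι → ℝ} (hc : Summable fun k => ‖c k‖)
    (b : ι →ᵇ Quaternion ℝ) : Summable fun k => c k • b k := by
  refine Summable.of_norm_bounded (hc.mul_right ‖b‖) fun k => ?_
  rw [norm_smul]
  exact mul_le_mul_of_nonneg_left (b.norm_coe_le_norm k) (norm_nonneg _)

/-- Summation of bounded families against an absolutely summable weight. -/
def weightedSum (c : ι → ℝ) (hc : Summable fun k => ‖c k‖) :
    (ι →ᵇ Quaternion ℝ) →L[ℝ] Quaternion ℝ :=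
  LinearMap.mkContinuous
    { toFun := fun b => ∑' k, c k • b k
      map_add' := fun b d => by
        simp only [BoundedContinuousFunction.add_apply, smul_add]
        exact (summable_smul_boundedContinuousFunction hc b).tsum_add
          (summable_smul_boundedContinuousFunction hc d)
      map_smul' := fun r b => by
        simp only [BoundedContinuousFunction.coe_smul, smul_comm _ r, RingHom.id_apply]
        exact (summable_smul_boundedContinuousFunction hc b).tsum_const_smul r }
    (∑' k, ‖c k‖) fun b => by
      rw [← tsum_mul_right]
      refine tsum_of_norm_bounded (hc.mul_right ‖b‖).hasSum fun k => ?_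
      rw [norm_smul]
      exact mul_le_mul_of_nonneg_left (b.norm_coe_le_norm k) (norm_nonneg _)

theorem weightedSum_apply {c : ι → ℝ} (hc : Summable fun k => ‖c k‖)
    (b : ι →ᵇ Quaternion ℝ) : weightedSum c hc b = ∑' k, c k • b k := rfl

theorem HolCliffordianAt.tsum_smul {c : ι → ℝ} (hc : Summable fun k => ‖c k‖)
    {Φ : Quaternion ℝ → ι →ᵇ Quaternion ℝ} {x : Quaternion ℝ} (hΦ : AnalyticAt ℝ Φ x)
    (h : ∀ k, HolCliffordianAt (fun y => c k • Φ y k) x) :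
    HolCliffordianAt (fun y => ∑' k, c k • Φ y k) x := by
  refine ⟨((weightedSum c hc).analyticAt _).comp hΦ, ?_⟩
  have hk : ∀ k i, vpd i (vlaplacian fun y => c k • Φ y k) x =
      c k • vpd i (vlaplacian Φ) x k := fun k i => by
    have e := vpd_vlaplacian_clm_comp
      (c k • BoundedContinuousFunction.evalCLM (β := Quaternion ℝ) ℝ k) hΦ i
    exact e
  have hs : HasSum (fun k i => vpd i (vlaplacian fun y => c k • Φ y k) x)
      (fun i => vpd i (vlaplacian fun y => ∑' k, c k • Φ y k) x) := by
    refine Pi.hasSum.2 fun i => ?_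
    have e := vpd_vlaplacian_clm_comp (weightedSum c hc) hΦ i
    simp only [weightedSum_apply] at e
    rw [e]
    simp only [hk]
    exact (summable_smul_boundedContinuousFunction hc _).hasSum
  have hclosed : IsClosed (fueterSystem : Set (Fin 4 → Quaternion ℝ)) :=
    fueterSystem.closed_of_finiteDimensional
  exact hclosed.mem_of_tendsto hs
    (.of_forall fun s => fueterSystem.sum_mem fun k _ => (h k).2)

/-- The general term of the series defining `ζ₄`. -/
def zetaTerm (w x : Quaternion ℝ) : Quaternion ℝ :=
  (x - w)⁻¹ + ∑ μ ∈ Finset.range 4, (w⁻¹ * x) ^ μ * w⁻¹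

theorem holCliffordianAt_zetaTerm {w x : Quaternion ℝ} (hx : x ≠ w) :
    HolCliffordianAt (zetaTerm w) x :=
  (HolCliffordianAt.sub_inv hx).add (HolCliffordianAt.sum_pow_mul w⁻¹)

theorem zetaTerm_eq {w x : Quaternion ℝ} (hw : w ≠ 0) (hx : x ≠ w) :
    zetaTerm w x = -((1 - w⁻¹ * x)⁻¹ * (w⁻¹ * x) ^ 4 * w⁻¹) := by
  have hu : 1 - w⁻¹ * x ≠ 0 := fun h => hx <| by
    have h1 : w * (w⁻¹ * x) = w * 1 := by rw [sub_eq_zero.1 h]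
    rwa [mul_inv_cancel_left₀ hw, mul_one] at h1
  have h1 : (x - w)⁻¹ = -((1 - w⁻¹ * x)⁻¹ * w⁻¹) := by
    rw [← mul_inv_rev, ← inv_neg, mul_sub, mul_one, mul_inv_cancel_left₀ hw, neg_sub]
  have h2 : ∑ μ ∈ Finset.range 4, (w⁻¹ * x) ^ μ =
      (1 - w⁻¹ * x)⁻¹ * (1 - (w⁻¹ * x) ^ 4) := by
    rw [eq_inv_mul_iff_mul_eq₀ hu, mul_neg_geom_sum]
  rw [zetaTerm, ← Finset.sum_mul, h1, h2]
  noncomm_ring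

theorem BoundedContinuousFunction.ringInverse_apply {b : ι →ᵇ Quaternion ℝ} (hb : IsUnit b)
    (k : ι) : (Ring.inverse b) k = (b k)⁻¹ := by
  refine eq_inv_of_mul_eq_one_left ?_
  rw [← BoundedContinuousFunction.mul_apply, Ring.inverse_mul_cancel b hb]
  rfl

theorem holCliffordianAt_tsum_zetaTerm [DiscreteTopology ι] {w : ι → Quaternion ℝ} {r : ℝ}
    {x : Quaternion ℝ} (hx : ‖x‖ < r)
    (hw : ∀ k, r ≤ ‖w k‖) (hs : Summable fun k => ‖w k‖⁻¹ ^ 5) :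
    HolCliffordianAt (fun y => ∑' k, zetaTerm (w k) y) x ∧
      Summable fun k => zetaTerm (w k) x := by
  have hr : 0 < r := (norm_nonneg x).trans_lt hx
  have hwpos : ∀ k, 0 < ‖w k‖ := fun k => hr.trans_le (hw k)
  have hw0 : ∀ k, w k ≠ 0 := fun k => norm_pos_iff.1 (hwpos k)
  have hne : ∀ y : Quaternion ℝ, ‖y‖ < r → ∀ k, y ≠ w k := fun y hy k h =>
    absurd (hw k) (by rw [← h]; exact hy.not_ge)
  let a : ι →ᵇ Quaternion ℝ := .ofNormedAddCommGroupDiscrete (fun k => (w k)⁻¹) r⁻¹ fun k => by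
    rw [norm_inv]
    exact inv_anti₀ hr (hw k)
  let u : ι →ᵇ Quaternion ℝ := .ofNormedAddCommGroupDiscrete (fun k => ‖w k‖ • (w k)⁻¹) 1
    fun k => by rw [norm_smul, norm_inv, norm_norm, mul_inv_cancel₀ (hwpos k).ne']
  let C : Quaternion ℝ →L[ℝ] (ι →ᵇ Quaternion ℝ) :=
    LinearMap.mkContinuous
      { toFun := BoundedContinuousFunction.const ι
        map_add' := fun _ _ => rfl
        map_smul' := fun _ _ => rfl } 1 fun y => by
      rw [one_mul]
      exact BoundedContinuousFunction.norm_const_le y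
  have hunit : ∀ y : Quaternion ℝ, ‖y‖ < r → IsUnit (1 - a * C y) := fun y hy => by
    refine isUnit_one_sub_of_norm_lt_one ?_
    have h1 : ‖a * C y‖ ≤ r⁻¹ * ‖y‖ :=
      (norm_mul_le _ _).trans (mul_le_mul
        (BoundedContinuousFunction.norm_ofNormedAddCommGroup_le _ (inv_pos.2 hr).le _)
        (BoundedContinuousFunction.norm_const_le y) (norm_nonneg _) (inv_pos.2 hr).le)
    refine h1.trans_lt ?_
    rwa [inv_mul_lt_one₀ hr]
  let Φ : Quaternion ℝ → ι →ᵇ Quaternion ℝ := fun y =>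
    -(Ring.inverse (1 - a * C y) * (u * C y) ^ 4 * u)
  have hΦ : AnalyticAt ℝ Φ x := by
    have hC : AnalyticAt ℝ (fun y => C y) x := C.analyticAt x
    have hinv : AnalyticAt ℝ (fun y => Ring.inverse (1 - a * C y)) x := by
      obtain ⟨z, hz⟩ := hunit x hx
      exact (hz ▸ analyticAt_inverse z :
        AnalyticAt ℝ Ring.inverse (1 - a * C x)).comp
          (f := fun y => 1 - a * C y) (analyticAt_const.fun_sub (analyticAt_const.fun_mul hC))
    exact ((hinv.fun_mul ((analyticAt_const.fun_mul hC).fun_pow 4)).fun_mul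
      analyticAt_const).fun_neg
  have hterm : ∀ y : Quaternion ℝ, ‖y‖ < r → ∀ k,
      ‖w k‖⁻¹ ^ 5 • Φ y k = zetaTerm (w k) y := fun y hy k => by
    have e : Φ y k = -((1 - (w k)⁻¹ * y)⁻¹ * ((‖w k‖ • (w k)⁻¹) * y) ^ 4 *
        (‖w k‖ • (w k)⁻¹)) := by
      have := BoundedContinuousFunction.ringInverse_apply (hunit y hy) k
      change -((Ring.inverse (1 - a * C y)) k * _ * _) = _
      rw [this]
      rfl
    rw [e, zetaTerm_eq (hw0 k) (hne y hy k)]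
    simp only [smul_mul_assoc, mul_smul_comm, smul_pow, smul_neg, smul_smul]
    rw [← pow_succ', ← mul_pow, inv_mul_cancel₀ (hwpos k).ne', one_pow, one_smul]
  have hnear : ∀ᶠ y in 𝓝 x, ‖y‖ < r := continuous_norm.continuousAt.eventually_lt_const hx
  have hs' : Summable fun k => ‖‖w k‖⁻¹ ^ 5‖ := hs.norm
  refine ⟨(HolCliffordianAt.tsum_smul hs' hΦ fun k => ?_).congr ?_, ?_⟩
  · refine (holCliffordianAt_zetaTerm (hne x hx k)).congr ?_
    filter_upwards [hnear] with y hy using (hterm y hy k).symm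
  · filter_upwards [hnear] with y hy using tsum_congr (hterm y hy)
  · simpa only [hterm x hx] using summable_smul_boundedContinuousFunction hs' (Φ x)

end LatticeSeries

section PeriodLattice

variable {ω : Fin 4 → Quaternion ℝ}

theorem wk_eq_sum_smul (ω : Fin 4 → Quaternion ℝ) (k : Fin 4 → ℤ) :
    wk ω k = ∑ i, k i • (2 * ω i) := by
  simp only [wk, Finset.mul_sum, mul_smul_comm, Int.cast_smul_eq_zsmul]

/-- The half-period basis doubled: a real basis of the quaternions generating the lattice. -/
def periodBasis (hω : LinearIndependent ℝ ω) : Module.Basis (Fin 4) ℝ (Quaternion ℝ) :=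
  (basisOfLinearIndependentOfCardEqFinrank hω (by simp [Quaternion.finrank_eq_four])).isUnitSMul
    (w := fun _ => (2 : ℝ)) fun _ => by simp

theorem periodBasis_apply (hω : LinearIndependent ℝ ω) (i : Fin 4) :
    periodBasis hω i = 2 * ω i := by
  simp [periodBasis, Module.Basis.isUnitSMul_apply, two_smul, two_mul]

theorem range_wk (hω : LinearIndependent ℝ ω) :
    Set.range (wk ω) = Submodule.span ℤ (Set.range (periodBasis hω)) := by
  ext x
  simp [Submodule.mem_span_range_iff_exists_fun, wk_eq_sum_smul, periodBasis_apply]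

theorem wk_injective (hω : LinearIndependent ℝ ω) : Function.Injective (wk ω) := by
  intro k l h
  have e : ∀ m : Fin 4 → ℤ, wk ω m = ∑ i, (m i : ℝ) • periodBasis hω i := fun m => by
    simp only [wk_eq_sum_smul, periodBasis_apply, Int.cast_smul_eq_zsmul]
  rw [e, e] at h
  funext i
  have hi := congrArg (fun x => (periodBasis hω).repr x i) h
  simpa [Finsupp.single_apply] using hi

theorem isClosed_range_wk (hω : LinearIndependent ℝ ω) : IsClosed (Set.range (wk ω)) := by
  rw [range_wk hω]
  exact AddSubgroup.isClosed_of_discrete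
    (H := (Submodule.span ℤ (Set.range (periodBasis hω))).toAddSubgroup)

theorem finite_norm_wk_lt (hω : LinearIndependent ℝ ω) (r : ℝ) :
    {k : Fin 4 → ℤ | ‖wk ω k‖ < r}.Finite := by
  have h := ZSpan.setFinite_inter (periodBasis hω) (s := Metric.ball 0 r) Metric.isBounded_ball
  rw [← range_wk hω] at h
  refine (h.preimage (wk_injective hω).injOn).subset fun k hk => ⟨?_, k, rfl⟩
  simpa using hk

theorem ZLattice.summable_norm_inv_pow_of_injective {E κ : Type*} [NormedAddCommGroup E]
    [NormedSpace ℝ E] [FiniteDimensional ℝ E] (L : Submodule ℤ E) [DiscreteTopology L] {n : ℕ}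
    (hL : Module.finrank ℤ L < n) {f : κ → E} (hf : Function.Injective f)
    (hmem : ∀ k, f k ∈ L) : Summable fun k => ‖f k‖⁻¹ ^ n := by
  have h := (ZLattice.summable_norm_pow_inv L n hL).comp_injective
    (i := fun k => (⟨f k, hmem k⟩ : L)) fun k l hkl => hf (congrArg Subtype.val hkl)
  simpa [Function.comp_def] using h

theorem summable_norm_wk_inv_pow (hω : LinearIndependent ℝ ω) :
    Summable fun k => ‖wk ω k‖⁻¹ ^ 5 := by
  have hrank : Module.finrank ℤ (Submodule.span ℤ (Set.range (periodBasis hω))) < 5 :=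
    (finrank_range_le_card (R := ℤ) (periodBasis hω)).trans_lt (by simp)
  refine ZLattice.summable_norm_inv_pow_of_injective _ hrank (wk_injective hω) fun k => ?_
  rw [← SetLike.mem_coe, ← range_wk hω]
  exact ⟨k, rfl⟩

theorem holCliffordianAt_zeta4 (hω : LinearIndependent ℝ ω) {x : Quaternion ℝ}
    (hx : x ∉ Set.range (wk ω)) : HolCliffordianAt (zeta4 ω) x := by
  have hxw : ∀ k, x ≠ wk ω k := fun k h => hx ⟨k, h.symm⟩
  have hfin : {k : {k : Fin 4 → ℤ // k ≠ 0} | ‖wk ω k.1‖ < ‖x‖ + 1}.Finite :=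
    (finite_norm_wk_lt hω (‖x‖ + 1)).preimage Subtype.val_injective.injOn
  set s := hfin.toFinset with hs
  have hsum : Summable fun k : {k : {k : Fin 4 → ℤ // k ≠ 0} // k ∉ s} =>
      ‖wk ω k.1.1‖⁻¹ ^ 5 :=
    (summable_norm_wk_inv_pow hω).comp_injective
      (Subtype.val_injective.comp Subtype.val_injective)
  have hlarge : ∀ k : {k : {k : Fin 4 → ℤ // k ≠ 0} // k ∉ s}, ‖x‖ + 1 ≤ ‖wk ω k.1.1‖ :=
    fun k => by simpa [hs] using k.2
  have htail := fun y (hy : ‖y‖ < ‖x‖ + 1) =>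
    holCliffordianAt_tsum_zetaTerm (w := fun k : {k : {k : Fin 4 → ℤ // k ≠ 0} // k ∉ s} =>
      wk ω k.1.1) hy hlarge hsum
  have h0 : HolCliffordianAt (fun y => y⁻¹) x := by
    have h := HolCliffordianAt.sub_inv (hxw 0)
    simpa [wk] using h
  have hhead := HolCliffordianAt.sum s (F := fun k => zetaTerm (wk ω k.1))
    fun k _ => holCliffordianAt_zetaTerm (hxw k.1)
  refine (h0.add (hhead.add (htail x (lt_add_one _)).1)).congr ?_
  filter_upwards [continuous_norm.continuousAt.eventually_lt_const (lt_add_one ‖x‖)] with y hy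
  have hsummable : Summable fun k : {k : Fin 4 → ℤ // k ≠ 0} => zetaTerm (wk ω k.1) y :=
    s.summable_compl_iff.1 (htail y hy).2
  exact congrArg (y⁻¹ + ·) (hsummable.sum_add_tsum_subtype_compl s)

end PeriodLattice

section Components

variable {F : Quaternion ℝ → Quaternion ℝ} {x : Quaternion ℝ}

theorem AnalyticAt.laplacian_qcomp (hF : AnalyticAt ℝ F x) (a : Fin 4) :
    AnalyticAt ℝ (laplacian fun y => qcomp a (F y)) x :=
  (((qcompL a).analyticAt _).comp hF).vlaplacian

theorem HolCliffordianAt.pd_laplacian_qcomp (hF : HolCliffordianAt F x) :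
    pd 0 (laplacian (fun y => qcomp 0 (F y))) x =
        pd 1 (laplacian (fun y => qcomp 1 (F y))) x
          + pd 2 (laplacian (fun y => qcomp 2 (F y))) x
          + pd 3 (laplacian (fun y => qcomp 3 (F y))) x ∧
    (∀ l : Fin 4, l ≠ 0 →
      pd 0 (laplacian (fun y => qcomp l (F y))) x =
        -pd l (laplacian (fun y => qcomp 0 (F y))) x) ∧
    (∀ i j : Fin 4, i ≠ 0 → j ≠ 0 →
      pd i (laplacian (fun y => qcomp j (F y))) x =
        pd j (laplacian (fun y => qcomp i (F y))) x) := by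
  have e : ∀ a i, pd i (laplacian (fun y => qcomp a (F y))) x =
      qcomp a (vpd i (vlaplacian F) x) := fun a i =>
    vpd_vlaplacian_clm_comp (qcompL a) hF.1 i
  simp only [e]
  exact hF.2

/-- A solution of the Cauchy–Riemann–Fueter system has harmonic components. -/
theorem laplacian_eq_zero_of_system {G : Fin 4 → Quaternion ℝ → ℝ}
    (hG : ∀ a, AnalyticAt ℝ (G a) x)
    (h0 : ∀ᶠ y in 𝓝 x, pd 0 (G 0) y = pd 1 (G 1) y + pd 2 (G 2) y + pd 3 (G 3) y)
    (h1 : ∀ l, l ≠ 0 → ∀ᶠ y in 𝓝 x, pd 0 (G l) y = -pd l (G 0) y)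
    (h2 : ∀ i j, i ≠ 0 → j ≠ 0 → ∀ᶠ y in 𝓝 x, pd i (G j) y = pd j (G i) y) (a : Fin 4) :
    laplacian (G a) x = 0 := by
  have comm : ∀ a i j, pd i (pd j (G a)) x = pd j (pd i (G a)) x := fun a i j =>
    vpd_comm (hG a) i j
  have hd : ∀ a i, DifferentiableAt ℝ (pd i (G a)) x := fun a i =>
    ((hG a).vpd i).differentiableAt
  have e0 : ∀ i, pd i (pd 0 (G 0)) x =
      pd i (pd 1 (G 1)) x + pd i (pd 2 (G 2)) x + pd i (pd 3 (G 3)) x := fun i => by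
    have h : pd i (pd 0 (G 0)) x = _ := (EventuallyEq.vpd (V := ℝ) h0 i).eq_of_nhds
    rw [h, vpd_add ((hd 1 1).fun_add (hd 2 2)) (hd 3 3), vpd_add (hd 1 1) (hd 2 2)]
    rfl
  have e1 : ∀ l, l ≠ 0 → ∀ i, pd i (pd 0 (G l)) x = -pd i (pd l (G 0)) x := fun l hl i => by
    have h : pd i (pd 0 (G l)) x = _ := (EventuallyEq.vpd (V := ℝ) (h1 l hl) i).eq_of_nhds
    rw [h]
    simp only [vpd, fderiv_fun_neg, neg_apply]
    rfl
  have e2 : ∀ i j, i ≠ 0 → j ≠ 0 → ∀ m, pd m (pd i (G j)) x = pd m (pd j (G i)) x :=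
    fun i j hi hj m => (EventuallyEq.vpd (V := ℝ) (h2 i j hi hj) m).eq_of_nhds
  by_cases ha : a = 0
  · subst ha
    have k1 := e1 1 (by decide) 1
    have k2 := e1 2 (by decide) 2
    have k3 := e1 3 (by decide) 3
    rw [comm] at k1 k2 k3
    simp only [laplacian, Fin.sum_univ_four]
    linarith [e0 0]
  · have k : ∀ j, j ≠ 0 → pd j (pd j (G a)) x = pd a (pd j (G j)) x := fun j hj => by
      rw [e2 j a hj ha, comm]
    have k0 : pd 0 (pd 0 (G a)) x = -pd a (pd 0 (G 0)) x := by
      rw [e1 a ha, comm]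
    simp only [laplacian, Fin.sum_univ_four, k0, k 1 (by decide), k 2 (by decide),
      k 3 (by decide)]
    linarith [e0 a]

end Components

/-- `ζ₄` is holomorphic Cliffordian off the lattice: it is smooth there, its real
components `g_a` are biharmonic, and the functions `G_a = Δg_a` satisfy the
componentwise form of the Cauchy–Riemann–Fueter system `DG = 0`. -/
theorem zeta4_holCliffordian (ω : Fin 4 → Quaternion ℝ)
    (hω : LinearIndependent ℝ ω) :
    ContDiffOn ℝ (⊤ : ℕ∞) (zeta4 ω) (Set.range (wk ω))ᶜ ∧
    (∀ a : Fin 4, ∀ x ∉ Set.range (wk ω),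
      laplacian (laplacian (fun y => qcomp a (zeta4 ω y))) x = 0) ∧
    (∀ x ∉ Set.range (wk ω),
      pd 0 (laplacian (fun y => qcomp 0 (zeta4 ω y))) x =
          pd 1 (laplacian (fun y => qcomp 1 (zeta4 ω y))) x
            + pd 2 (laplacian (fun y => qcomp 2 (zeta4 ω y))) x
            + pd 3 (laplacian (fun y => qcomp 3 (zeta4 ω y))) x ∧
      (∀ l : Fin 4, l ≠ 0 →
        pd 0 (laplacian (fun y => qcomp l (zeta4 ω y))) x =
          -pd l (laplacian (fun y => qcomp 0 (zeta4 ω y))) x) ∧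
      (∀ i j : Fin 4, i ≠ 0 → j ≠ 0 →
        pd i (laplacian (fun y => qcomp j (zeta4 ω y))) x =
          pd j (laplacian (fun y => qcomp i (zeta4 ω y))) x)) := by
  have hol : ∀ x ∉ Set.range (wk ω), HolCliffordianAt (zeta4 ω) x := fun x hx =>
    holCliffordianAt_zeta4 hω hx
  refine ⟨fun x hx => (hol x hx).1.contDiffAt.contDiffWithinAt, fun a x hx => ?_,
    fun x hx => (hol x hx).pd_laplacian_qcomp⟩
  have hev : ∀ᶠ y in 𝓝 x, HolCliffordianAt (zeta4 ω) y := by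
    filter_upwards [(isClosed_range_wk hω).isOpen_compl.mem_nhds hx] with y hy using hol y hy
  refine laplacian_eq_zero_of_system (G := fun a => laplacian fun y => qcomp a (zeta4 ω y))
    (fun a => (hol x hx).1.laplacian_qcomp a) ?_ (fun l hl => ?_) (fun i j hi hj => ?_) a
  · filter_upwards [hev] with y hy using hy.pd_laplacian_qcomp.1
  · filter_upwards [hev] with y hy using hy.pd_laplacian_qcomp.2.1 l hl
  · filter_upwards [hev] with y hy using hy.pd_laplacian_qcomp.2.2 i j hi hj

end
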